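/- arXiv:2207.11587 — 2 statements merged into one kernel-verified Lean document; each statement's English description precedes it below -/
import Mathlib

section
/- Every primary ideal in a normal uniform algebra is local: if A is a normal uniform algebra on a compact Hausdorff space X and I is an ideal of A contained in exactly one maximal ideal, say I ⊆ M_φ for the character φ ∈ M_A, then J_φ ⊆ I. -/
open WeakDual Topology

set_option synthInstance.maxHeartbeats 400000
set_option maxHeartbeats 1000000
set_option linter.unusedSectionVars false

noncomputable section

variable {X : Type*} [TopologicalSpace X]

/-- A uniform algebra on `X`: a closed point-separating subalgebra of `C(X, ℂ)`
(it automatically contains the constant functions, being a subalgebra). -/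
def IsUniformAlgebra (A : Subalgebra ℂ C(X, ℂ)) : Prop :=
  IsClosed (A : Set C(X, ℂ)) ∧ ∀ x y : X, x ≠ y → ∃ f ∈ A, f x ≠ f y

/-- The character of evaluation at a point `x ∈ X`. -/
def evalChar (A : Subalgebra ℂ C(X, ℂ)) (x : X) : characterSpace ℂ A :=
  ⟨{ toFun := fun f => (f : C(X, ℂ)) x
     map_add' := fun f g => rfl
     map_smul' := fun c f => rfl
     cont := (ContinuousEvalConst.continuous_eval_const x).comp continuous_subtype_val },
   ⟨by
      intro h
      have h1 : ((1 : A) : C(X, ℂ)) x = 0 := DFunLike.congr_fun h 1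
      simp at h1,
    fun f g => rfl⟩⟩

/-- The continuous linear functional on `A` underlying a character,
as an element of the normed dual of `A`. -/
def charDual {A : Type*} [NonUnitalNonAssocSemiring A] [TopologicalSpace A] [Module ℂ A]
    (φ : characterSpace ℂ A) : A →L[ℂ] ℂ := φ.1

/-- The set `J_φ` of elements of `A` whose Gelfand transform vanishes on a
neighborhood of `φ` in the maximal ideal space of `A`. -/
def vanishNearSet (A : Subalgebra ℂ C(X, ℂ)) (φ : characterSpace ℂ A) : Set A :=
  {f | ∃ U ∈ 𝓝 φ, ∀ ψ ∈ U, ψ f = 0}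

/-- `A` is normal on `X`: disjoint closed sets are separated by a `0`-`1` valued
pair of values of some function in `A`. -/
def IsNormalOn (A : Subalgebra ℂ C(X, ℂ)) : Prop :=
  ∀ K₀ K₁ : Set X, IsClosed K₀ → IsClosed K₁ → Disjoint K₀ K₁ →
    ∃ f ∈ A, (∀ x ∈ K₀, f x = 0) ∧ (∀ x ∈ K₁, f x = 1)

/-- `A` is strongly regular at `x`: `J_x` is dense in `M_x`. -/
def StronglyRegularAt (A : Subalgebra ℂ C(X, ℂ)) (x : X) : Prop :=
  {f : A | (f : C(X, ℂ)) x = 0} ⊆ closure (vanishNearSet A (evalChar A x))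

/-- `d` is a point derivation sequence of order `n` at `φ`: `d⁰ = φ` and the
Leibniz identities hold for `1 ≤ k ≤ n` (linearity/continuity of the `d k` is
imposed by the type at which this is used). -/
def IsDerivSeq {A : Type*} [Mul A] (φ : A → ℂ) (n : ℕ∞) (d : ℕ → A → ℂ) : Prop :=
  (∀ f, d 0 f = φ f) ∧
  ∀ k : ℕ, 1 ≤ k → (k : ℕ∞) ≤ n → ∀ f g,
    d k (f * g) = ∑ j ∈ Finset.range (k + 1), d j f * d (k - j) g

variable [CompactSpace X]

/-- `A` has bounded relative units at `x`. -/
def HasBoundedRelativeUnits (A : Subalgebra ℂ C(X, ℂ)) (x : X) : Prop :=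
  ∃ C : ℝ, 0 < C ∧ ∀ K : Set X, IsCompact K → x ∉ K →
    ∃ f : A, f ∈ vanishNearSet A (evalChar A x) ∧
      (∀ y ∈ K, (f : C(X, ℂ)) y = 1) ∧ ‖(f : C(X, ℂ))‖ ≤ C

/-- `x` is a generalized peak point for `A`. -/
def IsGeneralizedPeakPoint (A : Subalgebra ℂ C(X, ℂ)) (x : X) : Prop :=
  ∀ U ∈ 𝓝 x, ∃ f ∈ A, f x = 1 ∧ ‖f‖ = 1 ∧ ∀ y ∉ U, ‖f y‖ < 1

/-- `P` is a Gleason part for `A`: the set of all characters at dual-norm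
distance `< 2` from some fixed character. -/
def IsGleasonPart (A : Subalgebra ℂ C(X, ℂ)) (P : Set (characterSpace ℂ A)) : Prop :=
  ∃ φ : characterSpace ℂ A, P = {ψ | ‖charDual φ - charDual ψ‖ < 2}

/-- The carrier set of Feinstein's algebra `A_x = cl(J_x) ⊕ ℂ·1`. -/
def feinsteinSet (A : Subalgebra ℂ C(X, ℂ)) (x : X) : Set C(X, ℂ) :=
  {h | ∃ g ∈ closure ((fun f : A => (f : C(X, ℂ))) '' vanishNearSet A (evalChar A x)),
    ∃ c : ℂ, h = g + algebraMap ℂ C(X, ℂ) c}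

/-- In a closed subalgebra of `C(X, ℂ)`, an element `u` is divisible by `g` as soon as `g` stays
within distance `1/2` of `1` wherever `u` does not vanish. -/
theorem exists_mul_eq_of_norm_one_sub_lt {X : Type*} [TopologicalSpace X] [CompactSpace X]
    {A : Subalgebra ℂ C(X, ℂ)} (hA : IsClosed (A : Set C(X, ℂ))) (u g : A)
    (h : ∀ x, (u : C(X, ℂ)) x ≠ 0 → ‖1 - (g : C(X, ℂ)) x‖ < 1 / 2) :
    ∃ q : A, q * g = u := by
  set F : ℕ → C(X, ℂ) := fun n => (u * (1 - g) ^ n : A) with hF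
  have hFx : ∀ n x, F n x = (u : C(X, ℂ)) x * (1 - (g : C(X, ℂ)) x) ^ n := by
    intro n x
    simp [hF]
  have hsum : Summable F := by
    refine Summable.of_norm_bounded
      (g := fun n => ‖(u : C(X, ℂ))‖ * (1 / 2 : ℝ) ^ n)
      (summable_geometric_two.mul_left _) fun n => ?_
    rw [ContinuousMap.norm_le _ (by positivity)]
    intro x
    rw [hFx, norm_mul, norm_pow]
    by_cases hx : (u : C(X, ℂ)) x = 0
    · rw [hx, norm_zero, zero_mul]
      positivity
    · gcongr
      · exact (u : C(X, ℂ)).norm_coe_le_norm x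
      · exact (h x hx).le
  have hmem : ∑' n, F n ∈ A :=
    hA.mem_of_tendsto hsum.hasSum
      (Filter.Eventually.of_forall fun s => A.sum_mem fun n _ => (u * (1 - g) ^ n : A).2)
  refine ⟨⟨_, hmem⟩, Subtype.ext (ContinuousMap.ext fun x => ?_)⟩
  change (∑' n, F n) x * (g : C(X, ℂ)) x = (u : C(X, ℂ)) x
  rw [← ContinuousMap.tsum_apply hsum x]
  simp only [hFx]
  by_cases hx : (u : C(X, ℂ)) x = 0
  · simp [hx]
  · have hlt : ‖1 - (g : C(X, ℂ)) x‖ < 1 := (h x hx).trans (by norm_num)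
    have hg : (g : C(X, ℂ)) x ≠ 0 := by
      intro h0
      simp [h0] at hlt
    rw [tsum_mul_left, tsum_geometric_of_norm_lt_one hlt, sub_sub_cancel,
      inv_mul_cancel_right₀ hg]

/-- If an ideal of a closed normal subalgebra of `C(X, ℂ)` has no common zero on a compact set `K`,
then it contains an element equal to `1` on `K`. -/
theorem exists_mem_ideal_eq_one_on {X : Type*} [TopologicalSpace X] [CompactSpace X] [T2Space X]
    {A : Subalgebra ℂ C(X, ℂ)} (hA : IsClosed (A : Set C(X, ℂ))) (hnormal : IsNormalOn A)
    (I : Ideal A) {K : Set X} (hK : IsCompact K)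
    (h : ∀ x ∈ K, ∃ g ∈ I, (g : C(X, ℂ)) x ≠ 0) :
    ∃ e ∈ I, ∀ x ∈ K, (e : C(X, ℂ)) x = 1 := by
  refine hK.induction_on (p := fun s => ∃ e ∈ I, ∀ x ∈ s, (e : C(X, ℂ)) x = 1)
    ⟨0, I.zero_mem, by simp⟩ ?_ ?_ ?_
  · rintro s t hst ⟨e, he, h1⟩
    exact ⟨e, he, fun x hx => h1 x (hst hx)⟩
  · rintro s t ⟨e, he, hs⟩ ⟨e', he', ht⟩
    refine ⟨e + e' - e * e', I.sub_mem (I.add_mem he he') (I.mul_mem_left _ he'), ?_⟩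
    rintro x (hx | hx)
    · simp [hs x hx]
    · simp [ht x hx]
  · intro x hx
    obtain ⟨g, hgI, hg⟩ := h x hx
    set c : A := algebraMap ℂ A ((g : C(X, ℂ)) x)⁻¹ * g with hc
    have hcI : c ∈ I := I.mul_mem_left _ hgI
    have hcx : (c : C(X, ℂ)) x = 1 := by
      simp [hc, hg]
    set V : Set X := {y | ‖1 - (c : C(X, ℂ)) y‖ < 1 / 2}
    have hV : IsOpen V := isOpen_lt (by fun_prop) continuous_const
    have hxV : x ∈ V := by
      change ‖1 - (c : C(X, ℂ)) x‖ < 1 / 2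
      simp [hcx]
    obtain ⟨t, ht, htc, htV⟩ := exists_mem_nhds_isClosed_subset (hV.mem_nhds hxV)
    obtain ⟨u, huA, hu0, hu1⟩ := hnormal Vᶜ t hV.isClosed_compl htc
      (Set.disjoint_left.2 fun y hy hyt => hy (htV hyt))
    obtain ⟨q, hq⟩ := exists_mul_eq_of_norm_one_sub_lt hA ⟨u, huA⟩ c fun y hy => by
      by_contra hyV
      exact hy (hu0 y hyV)
    exact ⟨t, mem_nhdsWithin_of_mem_nhds ht, ⟨u, huA⟩, hq ▸ I.mul_mem_left q hcI, hu1⟩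

/-- The map sending a point to the corresponding evaluation character is continuous. -/
theorem continuous_evalChar {X : Type*} [TopologicalSpace X] (A : Subalgebra ℂ C(X, ℂ)) :
    Continuous (evalChar A) :=
  continuous_induced_rng.2
    (WeakDual.continuous_of_continuous_eval fun f => (f : C(X, ℂ)).continuous)

/-- Every primary ideal in a normal uniform algebra is local: if the
ideal `I` is contained in the kernel of exactly one character `φ`, then `J_φ ⊆ I`. -/
theorem vanishNearSet_subset_of_primary_ideal
    {X : Type*} [TopologicalSpace X] [CompactSpace X] [T2Space X]
    (A : Subalgebra ℂ C(X, ℂ)) (hA : IsUniformAlgebra A) (hnormal : IsNormalOn A)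
    (I : Ideal A) (φ : characterSpace ℂ A)
    (hsub : ∀ f ∈ I, φ f = 0)
    (huniq : ∀ ψ : characterSpace ℂ A, (∀ f ∈ I, ψ f = 0) → ψ = φ) :
    ∀ f ∈ vanishNearSet A φ, f ∈ I := by
  rintro f ⟨U, hU, hfU⟩
  obtain ⟨e, heI, he⟩ := exists_mem_ideal_eq_one_on hA.1 hnormal I
    (isClosed_tsupport (f : C(X, ℂ))).isCompact fun x hx => by
      by_contra! h0
      obtain rfl := huniq (evalChar A x) h0
      have hev : ∀ᶠ y in 𝓝 x, (f : C(X, ℂ)) y = 0 :=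
        ((continuous_evalChar A).continuousAt.eventually hU).mono fun y hy => hfU _ hy
      exact (notMem_tsupport_iff_eventuallyEq.2 hev) hx
  have hfe : f * e = f := by
    refine Subtype.ext (ContinuousMap.ext fun x => ?_)
    change (f : C(X, ℂ)) x * (e : C(X, ℂ)) x = (f : C(X, ℂ)) x
    by_cases hx : x ∈ tsupport (f : C(X, ℂ))
    · rw [he x hx, mul_one]
    · rw [image_eq_zero_of_notMem_tsupport hx, zero_mul]
  exact hfe ▸ I.mul_mem_left f heI

end
end

section
/- Let A be a uniform algebra and let φ, ψ be characters of A. Then ‖φ − ψ‖ < 2 in the dual-space norm of A* if and only if sup{|ψ(f)| : f ∈ A, ‖f‖ ≤ 1, φ(f) = 0} < 1. -/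
open WeakDual Topology

set_option synthInstance.maxHeartbeats 400000
set_option maxHeartbeats 1000000
set_option linter.unusedSectionVars false

noncomputable section

variable {X : Type*} [TopologicalSpace X]

variable [CompactSpace X]

theorem Complex.norm_sub_le_norm_one_sub_conj_mul {a z : ℂ} (ha : ‖a‖ ≤ 1) (hz : ‖z‖ ≤ 1) :
    ‖z - a‖ ≤ ‖1 - (starRingEnd ℂ) a * z‖ := by
  have key : ‖1 - (starRingEnd ℂ) a * z‖ ^ 2 - ‖z - a‖ ^ 2 =
      (1 - ‖a‖ ^ 2) * (1 - ‖z‖ ^ 2) := by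
    simp only [← Complex.normSq_eq_norm_sq, Complex.normSq_apply]
    simp
    ring
  have ha' : 0 ≤ 1 - ‖a‖ ^ 2 := by nlinarith [norm_nonneg a]
  have hz' : 0 ≤ 1 - ‖z‖ ^ 2 := by nlinarith [norm_nonneg z]
  exact le_of_sq_le_sq (by nlinarith [mul_nonneg ha' hz']) (norm_nonneg _)

theorem Subalgebra.nonempty_of_character {X : Type*} [TopologicalSpace X]
    {A : Subalgebra ℂ C(X, ℂ)} (φ : characterSpace ℂ A) : Nonempty X := by
  by_contra h
  rw [not_nonempty_iff] at h
  have h1 : (1 : A) = 0 := Subtype.ext (ContinuousMap.ext fun x => h.elim x)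
  have h2 : φ (1 : A) = φ (0 : A) := congrArg φ h1
  simp at h2

/-- The unit ball of a closed subalgebra of `C(X, ℂ)` is stable under the disc automorphisms
`z ↦ (z - a) / (1 - conj a * z)`. -/
theorem Subalgebra.exists_moebius {X : Type*} [TopologicalSpace X] [CompactSpace X] [Nonempty X]
    {A : Subalgebra ℂ C(X, ℂ)} (hA : IsClosed (A : Set C(X, ℂ))) {f : A} (hf : ‖f‖ ≤ 1)
    {a : ℂ} (ha : ‖a‖ < 1) :
    ∃ g : A, ‖g‖ ≤ 1 ∧
      g * (1 - algebraMap ℂ A ((starRingEnd ℂ) a) * f) = f - algebraMap ℂ A a := by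
  have : CompleteSpace A := hA.isComplete.completeSpace_coe
  have hsmall : ‖algebraMap ℂ A ((starRingEnd ℂ) a) * f‖ < 1 := by
    rw [← Algebra.smul_def, norm_smul, RCLike.norm_conj]
    exact (mul_le_of_le_one_right (norm_nonneg _) hf).trans_lt ha
  obtain ⟨u, hu⟩ := isUnit_one_sub_of_norm_lt_one hsmall
  have hg : ((f - algebraMap ℂ A a) * ↑u⁻¹) * (1 - algebraMap ℂ A ((starRingEnd ℂ) a) * f) =
      f - algebraMap ℂ A a := by
    rw [← hu, Units.inv_mul_cancel_right]
  refine ⟨_, ?_, hg⟩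
  generalize (f - algebraMap ℂ A a) * ↑u⁻¹ = g at hg
  refine (ContinuousMap.norm_le (g : C(X, ℂ)) zero_le_one).2 fun x => ?_
  have hfx : ‖(f : C(X, ℂ)) x‖ ≤ 1 := ((f : C(X, ℂ)).norm_coe_le_norm x).trans hf
  have hx : (g : C(X, ℂ)) x * (1 - (starRingEnd ℂ) a * (f : C(X, ℂ)) x) =
      (f : C(X, ℂ)) x - a :=
    congrArg (fun h : A => (h : C(X, ℂ)) x) hg
  have hpos : 0 < ‖1 - (starRingEnd ℂ) a * (f : C(X, ℂ)) x‖ := by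
    refine norm_pos_iff.2 (sub_ne_zero.2 fun h => ?_)
    have h' := congrArg norm h
    rw [norm_one, norm_mul, RCLike.norm_conj] at h'
    exact (mul_le_of_le_one_right (norm_nonneg a) hfx).trans_lt ha |>.ne' h'
  refine le_of_mul_le_mul_right ?_ hpos
  rw [← norm_mul, hx, one_mul]
  exact Complex.norm_sub_le_norm_one_sub_conj_mul ha.le hfx

theorem character_apply_moebius {A : Type*} [CommRing A] [TopologicalSpace A] [Algebra ℂ A]
    (φ : characterSpace ℂ A) {f g : A} {a b : ℂ}
    (h : g * (1 - algebraMap ℂ A b * f) = f - algebraMap ℂ A a) :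
    φ g * (1 - b * φ f) = φ f - a := by
  simpa [AlgHomClass.commutes] using congrArg φ h

theorem norm_character_apply_le {X : Type*} [TopologicalSpace X] [CompactSpace X]
    {A : Subalgebra ℂ C(X, ℂ)} (hA : IsClosed (A : Set C(X, ℂ))) (φ : characterSpace ℂ A)
    (f : A) : ‖φ f‖ ≤ ‖f‖ := by
  have : Nonempty X := Subalgebra.nonempty_of_character φ
  have : CompleteSpace A := hA.isComplete.completeSpace_coe
  have : NormOneClass A := ⟨norm_one (α := C(X, ℂ))⟩
  exact AlgHom.norm_apply_le_self φ f

/-- Two characters `φ, ψ` of a uniform algebra satisfy `‖φ - ψ‖ < 2`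
iff `sup {|ψ(f)| : f ∈ A, ‖f‖ ≤ 1, φ(f) = 0} < 1`. -/
theorem gleason_same_part_iff
    {X : Type*} [TopologicalSpace X] [CompactSpace X] [T2Space X]
    (A : Subalgebra ℂ C(X, ℂ)) (hA : IsUniformAlgebra A)
    (φ ψ : characterSpace ℂ A) :
    ‖charDual φ - charDual ψ‖ < 2 ↔
      sSup {r : ℝ | ∃ f : A, ‖(f : C(X, ℂ))‖ ≤ 1 ∧ φ f = 0 ∧ r = ‖ψ f‖} < 1 := by
  have : Nonempty X := Subalgebra.nonempty_of_character φ
  have hle := norm_character_apply_le hA.1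
  constructor
  · intro hN
    set t : ℝ := ‖charDual φ - charDual ψ‖ / 2 with ht
    have ht0 : 0 ≤ t := by positivity
    have ht1 : t < 1 := by linarith
    have hbound : 2 * t / (1 + t ^ 2) < 1 := by
      rw [div_lt_one (by positivity)]
      nlinarith [sq_pos_of_pos (sub_pos.2 ht1)]
    refine lt_of_le_of_lt (csSup_le ⟨0, 0, by simp⟩ ?_) hbound
    rintro r ⟨f, hf, hφf, rfl⟩
    obtain ⟨u, hu, hψu⟩ := RCLike.exists_norm_eq_mul_self (ψ f)
    set r : ℝ := ‖ψ f‖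
    have hr1 : r ≤ 1 := (hle ψ f).trans hf
    have huf : ‖u • f‖ ≤ 1 := by rw [norm_smul, hu, one_mul]; exact hf
    have hnt : ‖(t : ℂ)‖ < 1 := by simpa [abs_of_nonneg ht0] using ht1
    obtain ⟨g, hg, hgeq⟩ := Subalgebra.exists_moebius hA.1 huf hnt
    have hφg := character_apply_moebius φ hgeq
    have hψg := character_apply_moebius ψ hgeq
    rw [map_smul, hφf, smul_zero, mul_zero, sub_zero, mul_one, zero_sub] at hφg
    rw [map_smul, smul_eq_mul, ← hψu, Complex.conj_ofReal] at hψg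
    have htr : 0 < 1 - t * r := by nlinarith [norm_nonneg (ψ f)]
    have hdiff : ‖ψ g - φ g‖ ≤ 2 * t := by
      have h := (charDual φ - charDual ψ).le_opNorm g
      have h' : (charDual φ - charDual ψ) g = φ g - ψ g := rfl
      rw [h', norm_sub_rev] at h
      nlinarith
    have hprod : (ψ g - φ g) * ((1 - t * r : ℝ) : ℂ) = ((r - t + t * (1 - t * r) : ℝ) : ℂ) := by
      rw [hφg]
      push_cast
      linear_combination hψg
    have hnorm := congrArg norm hprod
    rw [norm_mul, Complex.norm_real, Complex.norm_real, Real.norm_of_nonneg htr.le] at hnorm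
    have h1 : r - t + t * (1 - t * r) ≤ 2 * t * (1 - t * r) :=
      (le_abs_self _).trans (hnorm.symm.le.trans (mul_le_mul_of_nonneg_right hdiff htr.le))
    rw [le_div_iff₀ (by positivity)]
    linarith
  · intro hs
    set S := {r : ℝ | ∃ f : A, ‖(f : C(X, ℂ))‖ ≤ 1 ∧ φ f = 0 ∧ r = ‖ψ f‖}
    have hS : BddAbove S := ⟨1, by rintro r ⟨f, hf, -, rfl⟩; exact (hle ψ f).trans hf⟩
    suffices h : ‖charDual φ - charDual ψ‖ ≤ sSup S * 2 by linarith
    rw [← ContinuousLinearMap.sSup_unit_ball_eq_norm]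
    refine csSup_le ((Metric.nonempty_ball.2 one_pos).image _) ?_
    rintro _ ⟨f, hf, rfl⟩
    rw [mem_ball_zero_iff] at hf
    have ha : ‖φ f‖ < 1 := (hle φ f).trans_lt hf
    have hb : ‖ψ f‖ ≤ 1 := (hle ψ f).trans hf.le
    obtain ⟨g, hg, hgeq⟩ := Subalgebra.exists_moebius hA.1 hf.le ha
    have hφg := character_apply_moebius φ hgeq
    have hψg := character_apply_moebius ψ hgeq
    have hne : 1 - (starRingEnd ℂ) (φ f) * φ f ≠ 0 := by
      rw [sub_ne_zero]
      intro h
      have h' := congrArg norm h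
      rw [norm_one, norm_mul, RCLike.norm_conj] at h'
      nlinarith [norm_nonneg (φ f)]
    rw [sub_self, mul_eq_zero, or_iff_left hne] at hφg
    have hgS : ‖ψ g‖ ≤ sSup S := le_csSup hS ⟨g, hg, hφg, rfl⟩
    have h2 : ‖1 - (starRingEnd ℂ) (φ f) * ψ f‖ ≤ 2 := by
      refine (norm_sub_le _ _).trans ?_
      rw [norm_one, norm_mul, RCLike.norm_conj]
      nlinarith [norm_nonneg (φ f), norm_nonneg (ψ f)]
    change ‖φ f - ψ f‖ ≤ _
    rw [norm_sub_rev, ← hψg, norm_mul]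
    exact mul_le_mul hgS h2 (norm_nonneg _) ((norm_nonneg _).trans hgS)

end
end
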